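/- Let $\varepsilon > 0$ be sufficiently small, and let $k_0$ be sufficiently large depending on $\varepsilon$. Then there exist integers $k, k' \in [k_0, k_0 + \varepsilon^{-2}]$ with $|k - k'| \le 1$ such that, with $I_j = [(1+\varepsilon)^j, (1+\varepsilon)^{j+1}]$, both $\sum_{p \in I_k} \frac{1}{p} \ge \frac{\varepsilon}{k}$ (sum over primes $p \in I_k$) and $\sum_{\substack{p_1 p_2 \in I_{k'} \\ p_1, p_2 \ge \exp(\varepsilon^3 k')}} \frac{1}{p_1 p_2} \ge \frac{\varepsilon}{k'}$ (sum over pairs of primes $(p_1,p_2)$ with $p_1 p_2 \in I_{k'}$ and both factors at least $\exp(\varepsilon^3 k')$). -/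

import Mathlib

section

open Finset Real
open ArithmeticFunction hiding log id
open scoped Chebyshev ArithmeticFunction.Moebius

theorem sum_Ioc_sum_Ioc_div (N : ℕ) (g : ℕ → ℕ → ℝ) :
    ∑ d ∈ Ioc 0 N, ∑ n ∈ Ioc 0 (N / d), g d n =
      ∑ m ∈ Ioc 0 N, ∑ q ∈ m.divisorsAntidiagonal, g q.1 q.2 := by
  rw [Finset.sum_sigma', Finset.sum_sigma']
  refine Finset.sum_nbij' (fun s => ⟨s.1 * s.2, (s.1, s.2)⟩) (fun s => ⟨s.2.1, s.2.2⟩) ?_ ?_ ?_ ?_ ?_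
  · rintro ⟨d, n⟩ h
    simp only [mem_sigma, mem_Ioc, Nat.mem_divisorsAntidiagonal] at h ⊢
    obtain ⟨⟨hd, hdN⟩, hn, hnN⟩ := h
    have := (Nat.le_div_iff_mul_le hd).1 hnN
    refine ⟨⟨by positivity, by linarith [mul_comm d n]⟩, trivial, by positivity⟩
  · rintro ⟨m, a, b⟩ h
    simp only [mem_sigma, mem_Ioc, Nat.mem_divisorsAntidiagonal] at h ⊢
    obtain ⟨⟨hm, hmN⟩, rfl, h0⟩ := h
    have ha : 0 < a := Nat.pos_of_ne_zero (by rintro rfl; simp at h0)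
    have hb : 0 < b := Nat.pos_of_ne_zero (by rintro rfl; simp at h0)
    refine ⟨⟨ha, le_trans (Nat.le_mul_of_pos_right a hb) hmN⟩, hb, ?_⟩
    rw [Nat.le_div_iff_mul_le ha]
    linarith [mul_comm a b]
  · rintro ⟨d, n⟩ h
    rfl
  · rintro ⟨m, a, b⟩ h
    simp only [mem_sigma, mem_Ioc, Nat.mem_divisorsAntidiagonal] at h
    obtain ⟨_, rfl, _⟩ := h
    rfl
  · rintro ⟨d, n⟩ h
    rfl

theorem abs_log_factorial_sub_le {n : ℕ} (hn : n ≠ 0) :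
    |log n.factorial - (n * log n - n)| ≤ log n + 1 := by
  have h1 : (1 : ℝ) ≤ n := by exact_mod_cast Nat.one_le_iff_ne_zero.2 hn
  have hl := log_nonneg h1
  have hlow := Stirling.le_log_factorial_stirling hn
  have hpi : 0 ≤ log (2 * π) := log_nonneg (by linarith [pi_gt_three])
  have hform := Stirling.log_stirlingSeq_formula n
  have hanti : log (Stirling.stirlingSeq n) ≤ log (Stirling.stirlingSeq 1) := by
    obtain ⟨m, rfl⟩ := Nat.exists_eq_succ_of_ne_zero hn
    exact Stirling.log_stirlingSeq'_antitone (Nat.zero_le m)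
  rw [Stirling.stirlingSeq_one, log_div (exp_ne_zero _) (by positivity), log_exp,
    log_sqrt (by norm_num)] at hanti
  rw [log_mul (by norm_num) (by positivity), log_div (by positivity) (exp_ne_zero _),
    log_exp] at hform
  rw [abs_le]
  constructor <;> nlinarith

theorem sum_Ioc_log (N : ℕ) : ∑ n ∈ Ioc 0 N, log (n : ℝ) = log N.factorial := by
  induction N with
  | zero => simp
  | succ n ih =>
    rw [← Finset.insert_Ioc_right_eq_Ioc_add_one (Nat.zero_le n), Finset.sum_insert (by simp), ih,
      Nat.factorial_succ, Nat.cast_mul, log_mul (by positivity) (by positivity)]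

theorem sum_antidiagonal_vonMangoldt_snd (m : ℕ) :
    ∑ q ∈ m.divisorsAntidiagonal, Λ q.2 = log m := by
  rw [Nat.sum_divisorsAntidiagonal' (f := fun _ b => Λ b), vonMangoldt_sum]

theorem sum_antidiagonal_vonMangoldt_fst (m : ℕ) :
    ∑ q ∈ m.divisorsAntidiagonal, Λ q.1 = log m := by
  rw [Nat.sum_divisorsAntidiagonal (f := fun a _ => Λ a), vonMangoldt_sum]

theorem sum_psi_div (x : ℝ) :
    ∑ n ∈ Ioc 0 ⌊x⌋₊, ψ (x / n) = log (⌊x⌋₊).factorial := by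
  simp_rw [Chebyshev.psi, Nat.floor_div_natCast]
  rw [sum_Ioc_sum_Ioc_div _ (fun _ b => Λ b)]
  simp_rw [sum_antidiagonal_vonMangoldt_snd, sum_Ioc_log]

theorem sum_vonMangoldt_mul_div (N : ℕ) :
    ∑ m ∈ Ioc 0 N, Λ m * ((N / m : ℕ) : ℝ) = log N.factorial := by
  have := sum_Ioc_sum_Ioc_div N (fun a _ => Λ a)
  simp_rw [sum_antidiagonal_vonMangoldt_fst, sum_Ioc_log] at this
  rw [← this]
  refine Finset.sum_congr rfl fun d _ => ?_
  simp [mul_comm]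

theorem abs_mul_log_sub_floor_le {x : ℝ} (hx : 1 ≤ x) :
    |x * log x - ⌊x⌋₊ * log ⌊x⌋₊| ≤ log x + 1 := by
  have hN : (1 : ℝ) ≤ (⌊x⌋₊ : ℝ) := by exact_mod_cast (Nat.one_le_floor_iff x).2 hx
  have h1 := Nat.floor_le (zero_le_one.trans hx)
  have h2 := (Nat.lt_floor_add_one x).le
  set N : ℝ := (⌊x⌋₊ : ℝ)
  have hlN := log_nonneg hN
  have hlx := log_nonneg hx
  have hle : log N ≤ log x := log_le_log (by linarith) h1
  have hd : N * (log x - log N) ≤ x - N := by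
    rw [← log_div (by linarith) (by linarith)]
    have := log_le_sub_one_of_pos (x := x / N) (by positivity)
    calc N * log (x / N) ≤ N * (x / N - 1) := by gcongr
      _ = x - N := by field_simp
  rw [abs_le]
  constructor <;> nlinarith

theorem exists_abs_sum_vonMangoldt_div_sub_log_le :
    ∃ C : ℝ, 0 ≤ C ∧ ∀ x : ℝ, 1 ≤ x → |∑ m ∈ Ioc 0 ⌊x⌋₊, Λ m / m - log x| ≤ C := by
  refine ⟨log 4 + 4 + 5, by positivity, fun x hx => ?_⟩
  have hx0 : 0 < x := by linarith
  have hN : (1 : ℝ) ≤ (⌊x⌋₊ : ℝ) := by exact_mod_cast (Nat.one_le_floor_iff x).2 hx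
  have h1 := Nat.floor_le hx0.le
  have h2 := (Nat.lt_floor_add_one x).le
  have hfac := abs_log_factorial_sub_le (n := ⌊x⌋₊) (by rintro h; simp [h] at hN; linarith)
  have hfl := abs_mul_log_sub_floor_le hx
  have hle : log (⌊x⌋₊ : ℝ) ≤ log x := log_le_log (by linarith) h1
  have hlog := log_le_sub_one_of_pos hx0
  have hpsi := Chebyshev.psi_le_const_mul_self hx0.le
  have hup : log (⌊x⌋₊).factorial ≤ x * ∑ m ∈ Ioc 0 ⌊x⌋₊, Λ m / m := by
    rw [← sum_vonMangoldt_mul_div, Finset.mul_sum]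
    refine Finset.sum_le_sum fun m hm => ?_
    have h3 : ((⌊x⌋₊ / m : ℕ) : ℝ) ≤ x / m := by
      rw [← Nat.floor_div_natCast]; exact Nat.floor_le (by positivity)
    calc Λ m * ((⌊x⌋₊ / m : ℕ) : ℝ) ≤ Λ m * (x / m) := by
          gcongr
      _ = _ := by ring
  have hlo : x * ∑ m ∈ Ioc 0 ⌊x⌋₊, Λ m / m ≤ log (⌊x⌋₊).factorial + ψ x := by
    rw [← sum_vonMangoldt_mul_div, Finset.mul_sum, Chebyshev.psi, ← Finset.sum_add_distrib]
    refine Finset.sum_le_sum fun m hm => ?_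
    have h3 : x / m ≤ ((⌊x⌋₊ / m : ℕ) : ℝ) + 1 := by
      rw [← Nat.floor_div_natCast]; exact (Nat.lt_floor_add_one _).le
    calc x * (Λ m / m) = Λ m * (x / m) := by ring
      _ ≤ Λ m * (((⌊x⌋₊ / m : ℕ) : ℝ) + 1) := by gcongr
      _ = _ := by ring
  rw [abs_le] at *
  have key : |x * (∑ m ∈ Ioc 0 ⌊x⌋₊, Λ m / m - log x)| ≤ x * (log 4 + 4 + 5) := by
    rw [abs_le]; constructor <;> nlinarith
  rw [abs_mul, abs_of_pos hx0] at key
  exact abs_le.1 (le_of_mul_le_mul_left key hx0)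

theorem abs_sum_psi_div_sub_le {x : ℝ} (hx : 1 ≤ x) :
    |∑ n ∈ Ioc 0 ⌊x⌋₊, (ψ (x / n) - x / n + (eulerMascheroniConstant + 1))| ≤
      4 * (log x + 1) := by
  have hx0 : 0 < x := by linarith
  have hN : (1 : ℝ) ≤ (⌊x⌋₊ : ℝ) := by exact_mod_cast (Nat.one_le_floor_iff x).2 hx
  have hN0 : ⌊x⌋₊ ≠ 0 := by rintro h; simp [h] at hN; linarith
  have h1 := Nat.floor_le hx0.le
  have h2 := (Nat.lt_floor_add_one x).le
  have hfac := abs_log_factorial_sub_le hN0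
  have hle : log (⌊x⌋₊ : ℝ) ≤ log x := log_le_log (by linarith) h1
  have hγ0 := one_half_lt_eulerMascheroniConstant
  have hγ1 := eulerMascheroniConstant_lt_two_thirds
  have hl := eulerMascheroniSeq_lt_eulerMascheroniConstant ⌊x⌋₊
  have hu := eulerMascheroniConstant_lt_eulerMascheroniSeq' ⌊x⌋₊
  rw [eulerMascheroniSeq', if_neg hN0] at hu
  rw [eulerMascheroniSeq] at hl
  have hharm : ((harmonic ⌊x⌋₊ : ℚ) : ℝ) = ∑ n ∈ Ioc 0 ⌊x⌋₊, (1 / n : ℝ) := by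
    rw [harmonic_eq_sum_Icc]
    push_cast
    simp [← Finset.Icc_add_one_left_eq_Ioc]
  have hsum : ∑ n ∈ Ioc 0 ⌊x⌋₊, (ψ (x / n) - x / n + (eulerMascheroniConstant + 1)) =
      log (⌊x⌋₊).factorial - x * (harmonic ⌊x⌋₊ : ℚ) +
        (eulerMascheroniConstant + 1) * ⌊x⌋₊ := by
    rw [Finset.sum_add_distrib, Finset.sum_sub_distrib, sum_psi_div, hharm, Finset.mul_sum]
    simp only [sum_const, Nat.card_Ioc, tsub_zero, nsmul_eq_mul, mul_one_div]
    ring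
  rw [hsum]
  set N : ℝ := (⌊x⌋₊ : ℝ)
  set γ := eulerMascheroniConstant
  set h : ℝ := ((harmonic ⌊x⌋₊ : ℚ) : ℝ)
  have hlog1 : log (N + 1) ≤ log N + 1 / N := by
    have := log_le_sub_one_of_pos (x := (N + 1) / N) (by positivity)
    rw [log_div (by positivity) (by positivity)] at this
    have h3 : (N + 1) / N - 1 = 1 / N := by field_simp; ring
    linarith
  have hlN := log_nonneg hN
  have hxN : x * (1 / N) ≤ 2 := by
    rw [mul_one_div, div_le_iff₀ (by linarith)]; linarith
  have hd0 : 0 ≤ x * (h - log N - γ) := mul_nonneg hx0.le (by linarith)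
  have hd1 : x * (h - log N - γ) ≤ 2 := by
    refine le_trans ?_ hxN
    gcongr
    linarith
  rw [abs_le] at *
  constructor <;> nlinarith

theorem sum_Ioc_one_div_sqrt_le (N : ℕ) : ∑ d ∈ Ioc 0 N, 1 / √(d : ℝ) ≤ 2 * √(N : ℝ) := by
  induction N with
  | zero => simp
  | succ n ih =>
    rw [← Finset.insert_Ioc_right_eq_Ioc_add_one (Nat.zero_le n), Finset.sum_insert (by simp)]
    have h1 : 1 / √((n + 1 : ℕ) : ℝ) ≤ 2 * (√((n + 1 : ℕ) : ℝ) - √(n : ℝ)) := by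
      have ha : 0 < √((n + 1 : ℕ) : ℝ) := by positivity
      have hb := sqrt_nonneg (n : ℝ)
      have ha2 := sq_sqrt (show (0 : ℝ) ≤ ((n + 1 : ℕ) : ℝ) by positivity)
      have hb2 := sq_sqrt (show (0 : ℝ) ≤ (n : ℝ) by positivity)
      push_cast at *
      rw [div_le_iff₀ ha]
      nlinarith [sq_nonneg (√((n : ℝ) + 1) - √(n : ℝ))]
    linarith

theorem log_mul_log_add_one_le {y : ℝ} (hy : 1 ≤ y) : log y * (log y + 1) ≤ 16 * √y := by
  have h0 : 0 < √(√y) := sqrt_pos.2 (sqrt_pos.2 (by linarith))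
  have h1 : log y = 4 * log (√(√y)) := by
    rw [log_sqrt (sqrt_nonneg _), log_sqrt (by linarith)]; ring
  have h2 := log_le_sub_one_of_pos h0
  have h3 := sq_sqrt (sqrt_nonneg y)
  have h4 := log_nonneg hy
  calc log y * (log y + 1) ≤ (4 * √(√y)) * (4 * √(√y)) := by
        apply mul_le_mul <;> linarith
    _ = 16 * √(√y) ^ 2 := by ring
    _ = 16 * √y := by rw [h3]

theorem sum_antidiagonal_moebius_mul_log {x : ℝ} (hx : 0 < x) (m : ℕ) :
    ∑ q ∈ m.divisorsAntidiagonal, (μ q.1 : ℝ) * log (x / q.1) =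
      (if m = 1 then log x else 0) + Λ m := by
  rw [Nat.sum_divisorsAntidiagonal (f := fun a _ => (μ a : ℝ) * log (x / a))]
  have h1 : ∀ d ∈ m.divisors, (μ d : ℝ) * log (x / d) = log x * (μ d : ℝ) - μ d * log d := by
    intro d hd
    have := (Nat.pos_of_mem_divisors hd).ne'
    rw [log_div hx.ne' (by exact_mod_cast this)]
    ring
  rw [Finset.sum_congr rfl h1, Finset.sum_sub_distrib, ← Finset.mul_sum]
  have h2 := sum_moebius_mul_log_eq (n := m)
  simp only [ArithmeticFunction.log_apply] at h2
  have h3 : ∑ d ∈ m.divisors, (μ d : ℝ) = if m = 1 then 1 else 0 := by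
    have := congrArg (fun f : ArithmeticFunction ℤ => f m) moebius_mul_coe_zeta
    simp only [coe_mul_zeta_apply, one_apply] at this
    exact_mod_cast this
  rw [h2, h3]
  split_ifs <;> simp

/-- The Tatuzawa–Iseki identity. -/
theorem sum_moebius_mul_log_mul_sum (F : ℝ → ℝ) {x : ℝ} (hx : 1 ≤ x) :
    ∑ d ∈ Ioc 0 ⌊x⌋₊, (μ d : ℝ) * log (x / d) * ∑ n ∈ Ioc 0 ⌊x / d⌋₊, F (x / d / n) =
      F x * log x + ∑ m ∈ Ioc 0 ⌊x⌋₊, Λ m * F (x / m) := by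
  simp_rw [Finset.mul_sum, Nat.floor_div_natCast]
  rw [sum_Ioc_sum_Ioc_div _ (fun d n => (μ d : ℝ) * log (x / d) * F (x / d / n))]
  have h1 : ∀ m ∈ Ioc 0 ⌊x⌋₊, ∑ q ∈ m.divisorsAntidiagonal,
      (μ q.1 : ℝ) * log (x / q.1) * F (x / q.1 / q.2) =
      (if m = 1 then F x * log x else 0) + Λ m * F (x / m) := by
    intro m _
    have h2 : ∀ q ∈ m.divisorsAntidiagonal,
        (μ q.1 : ℝ) * log (x / q.1) * F (x / q.1 / q.2) =
        (μ q.1 : ℝ) * log (x / q.1) * F (x / m) := by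
      intro q hq
      rw [← (Nat.mem_divisorsAntidiagonal.1 hq).1, div_div, Nat.cast_mul]
    rw [Finset.sum_congr rfl h2, ← Finset.sum_mul,
      sum_antidiagonal_moebius_mul_log (by linarith), add_mul]
    split_ifs with h
    · simp [h, mul_comm]
    · simp
  rw [Finset.sum_congr rfl h1, Finset.sum_add_distrib, Finset.sum_ite_eq']
  have : 1 ∈ Ioc 0 ⌊x⌋₊ := by
    simp only [mem_Ioc, zero_lt_one, true_and]; exact (Nat.one_le_floor_iff x).2 hx
  simp [this]

/-- Selberg's symmetry formula. -/
theorem exists_abs_selberg_le :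
    ∃ C : ℝ, 0 ≤ C ∧ ∀ x : ℝ, 1 ≤ x →
      |ψ x * log x + ∑ m ∈ Ioc 0 ⌊x⌋₊, Λ m * ψ (x / m) - 2 * x * log x| ≤ C * x := by
  obtain ⟨C, hC0, hC⟩ := exists_abs_sum_vonMangoldt_div_sub_log_le
  refine ⟨128 + C + 2 * (log 4 + 4) + 2, by positivity, fun x hx => ?_⟩
  have hx0 : 0 < x := by linarith
  set γ := eulerMascheroniConstant with hγ
  have hγ0 := one_half_lt_eulerMascheroniConstant
  have hγ1 := eulerMascheroniConstant_lt_two_thirds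
  have hid := sum_moebius_mul_log_mul_sum (fun t => ψ t - t + (γ + 1)) hx
  have hbound : |∑ d ∈ Ioc 0 ⌊x⌋₊, (μ d : ℝ) * log (x / d) *
      ∑ n ∈ Ioc 0 ⌊x / d⌋₊, (ψ (x / d / n) - x / d / n + (γ + 1))| ≤ 128 * x := by
    calc _ ≤ ∑ d ∈ Ioc 0 ⌊x⌋₊, |(μ d : ℝ) * log (x / d) *
          ∑ n ∈ Ioc 0 ⌊x / d⌋₊, (ψ (x / d / n) - x / d / n + (γ + 1))| :=
          Finset.abs_sum_le_sum_abs _ _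
      _ ≤ ∑ d ∈ Ioc 0 ⌊x⌋₊, 64 * √x * (1 / √(d : ℝ)) := by
          refine Finset.sum_le_sum fun d hd => ?_
          obtain ⟨hd0, hdx⟩ := mem_Ioc.1 hd
          have hd' : (0 : ℝ) < d := by exact_mod_cast hd0
          have hy : 1 ≤ x / d := by
            rw [one_le_div hd']; exact (Nat.le_floor_iff hx0.le).1 hdx
          have hμ : |(μ d : ℝ)| ≤ 1 := by exact_mod_cast abs_moebius_le_one
          rw [abs_mul, abs_mul, abs_of_nonneg (log_nonneg hy)]
          calc _ ≤ 1 * log (x / d) * (4 * (log (x / d) + 1)) := by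
                have hly := log_nonneg hy
                exact mul_le_mul (mul_le_mul_of_nonneg_right hμ hly) (abs_sum_psi_div_sub_le hy)
                  (abs_nonneg _) (by linarith)
            _ = 4 * (log (x / d) * (log (x / d) + 1)) := by ring
            _ ≤ 4 * (16 * √(x / d)) := by linarith [log_mul_log_add_one_le hy]
            _ = _ := by rw [sqrt_div hx0.le]; ring
      _ = 64 * √x * ∑ d ∈ Ioc 0 ⌊x⌋₊, (1 / √(d : ℝ)) := by rw [Finset.mul_sum]
      _ ≤ 64 * √x * (2 * √(⌊x⌋₊ : ℝ)) := by gcongr; exact sum_Ioc_one_div_sqrt_le _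
      _ ≤ 64 * √x * (2 * √x) := by gcongr; exact Nat.floor_le hx0.le
      _ = 128 * (√x * √x) := by ring
      _ = 128 * x := by rw [mul_self_sqrt hx0.le]
  rw [hid] at hbound
  have hexp : ∑ m ∈ Ioc 0 ⌊x⌋₊, Λ m * (ψ (x / m) - x / m + (γ + 1)) =
      ∑ m ∈ Ioc 0 ⌊x⌋₊, Λ m * ψ (x / m) - x * ∑ m ∈ Ioc 0 ⌊x⌋₊, Λ m / m + (γ + 1) * ψ x := by
    rw [Chebyshev.psi, Finset.mul_sum, Finset.mul_sum, ← Finset.sum_sub_distrib,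
      ← Finset.sum_add_distrib]
    refine Finset.sum_congr rfl fun m _ => by ring
  rw [hexp] at hbound
  have hM := hC x hx
  have hpsi := Chebyshev.psi_le_const_mul_self hx0.le
  have hpsi0 := Chebyshev.psi_nonneg x
  have hlog := log_le_sub_one_of_pos hx0
  have hlog0 := log_nonneg hx
  set M := ∑ m ∈ Ioc 0 ⌊x⌋₊, Λ m / m
  have hM' : |x * (M - log x)| ≤ x * C := by
    rw [abs_mul, abs_of_pos hx0]; gcongr
  have hγψ : (γ + 1) * ψ x ≤ 2 * ((log 4 + 4) * x) := by gcongr; linarith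
  have hγψ0 : 0 ≤ (γ + 1) * ψ x := mul_nonneg (by linarith) hpsi0
  have hγl : (γ + 1) * log x ≤ 2 * x := by
    calc (γ + 1) * log x ≤ 2 * (x - 1) := by gcongr; linarith
      _ ≤ 2 * x := by linarith
  have hγl0 : 0 ≤ (γ + 1) * log x := mul_nonneg (by linarith) hlog0
  rw [abs_le] at *
  constructor <;> linarith

theorem sum_Ioc_floor_div (f : ℕ → ℝ) {u y : ℝ} (hu : 0 ≤ u) (huy : u ≤ y) {a : ℕ}
    (ha : 0 < a) :
    ∑ b ∈ Ioc 0 ⌊u / a⌋₊, f b = ∑ b ∈ Ioc 0 ⌊y⌋₊, if (a * b : ℝ) ≤ u then f b else 0 := by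
  have ha' : (0 : ℝ) < a := by exact_mod_cast ha
  rw [← Finset.sum_filter]
  refine Finset.sum_congr ?_ fun _ _ => rfl
  ext b
  simp only [mem_Ioc, mem_filter]
  rw [Nat.le_floor_iff (by positivity), Nat.le_floor_iff (hu.trans huy), le_div_iff₀ ha',
    mul_comm]
  constructor
  · rintro ⟨h1, h2⟩
    refine ⟨⟨h1, ?_⟩, h2⟩
    have h3 : (1 : ℝ) ≤ a := by exact_mod_cast ha
    have h4 : (0 : ℝ) ≤ b := Nat.cast_nonneg b
    nlinarith
  · rintro ⟨⟨h1, _⟩, h2⟩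
    exact ⟨h1, h2⟩

theorem sum_Ioc_floor_div_sub (f : ℕ → ℝ) {x y : ℝ} (hx : 0 ≤ x) (hxy : x ≤ y) {a : ℕ}
    (ha : 0 < a) :
    ∑ b ∈ Ioc 0 ⌊y / a⌋₊, f b - ∑ b ∈ Ioc 0 ⌊x / a⌋₊, f b =
      ∑ b ∈ Ioc 0 ⌊y⌋₊, if x < (a * b : ℝ) ∧ (a * b : ℝ) ≤ y then f b else 0 := by
  rw [sum_Ioc_floor_div f hx hxy ha, sum_Ioc_floor_div f (hx.trans hxy) le_rfl ha,
    ← Finset.sum_sub_distrib]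
  refine Finset.sum_congr rfl fun b _ => ?_
  by_cases h1 : (a * b : ℝ) ≤ x
  · simp [h1, h1.trans hxy, not_lt.2 h1]
  · simp [h1, lt_of_not_ge h1]

theorem sum_Ioc_floor_sub (f : ℕ → ℝ) {x y : ℝ} (hx : 0 ≤ x) (hxy : x ≤ y) :
    ∑ b ∈ Ioc 0 ⌊y⌋₊, f b - ∑ b ∈ Ioc 0 ⌊x⌋₊, f b =
      ∑ b ∈ Ioc 0 ⌊y⌋₊, if x < (b : ℝ) ∧ (b : ℝ) ≤ y then f b else 0 := by
  simpa using sum_Ioc_floor_div_sub f hx hxy (a := 1) one_pos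

theorem sum_mul_sum_Ioc_floor_div_sub (g f : ℕ → ℝ) {x y : ℝ} (hx : 0 ≤ x) (hxy : x ≤ y) :
    ∑ a ∈ Ioc 0 ⌊y⌋₊, g a * (∑ b ∈ Ioc 0 ⌊y / a⌋₊, f b - ∑ b ∈ Ioc 0 ⌊x / a⌋₊, f b) =
      ∑ a ∈ Ioc 0 ⌊y⌋₊, ∑ b ∈ Ioc 0 ⌊y⌋₊,
        if x < (a * b : ℝ) ∧ (a * b : ℝ) ≤ y then g a * f b else 0 := by
  refine Finset.sum_congr rfl fun a ha => ?_
  rw [sum_Ioc_floor_div_sub f hx hxy (mem_Ioc.1 ha).1, Finset.mul_sum]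
  simp only [mul_ite, mul_zero]

theorem exists_sum_nonprime_vonMangoldt_div_le :
    ∃ K : ℝ, 0 ≤ K ∧ ∀ N : ℕ, ∑ m ∈ Ioc 0 N, (if m.Prime then 0 else Λ m) / m ≤ K := by
  have h := vonMangoldt.summable_residueClass_non_primes_div (q := 1) 0
  have hres : ∀ n : ℕ, vonMangoldt.residueClass (0 : ZMod 1) n = Λ n := by
    intro n
    simp [vonMangoldt.residueClass, Subsingleton.elim (n : ZMod 1) 0]
  simp only [hres] at h
  have h0 : ∀ m : ℕ, 0 ≤ (if m.Prime then 0 else Λ m) / (m : ℝ) := by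
    intro m
    split_ifs
    · simp
    · exact div_nonneg vonMangoldt_nonneg (Nat.cast_nonneg _)
  exact ⟨_, tsum_nonneg h0, fun N => h.sum_le_tsum _ fun m _ => h0 m⟩

/-- The partial sums of `log p / p` over primes. -/
noncomputable def primeLogSum (x : ℝ) : ℝ :=
  ∑ p ∈ Ioc 0 ⌊x⌋₊, if p.Prime then log p / p else 0

/-- Mertens' first theorem. -/
theorem exists_abs_primeLogSum_sub_log_le :
    ∃ C : ℝ, 0 ≤ C ∧ ∀ x : ℝ, 1 ≤ x → |primeLogSum x - log x| ≤ C := by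
  obtain ⟨C, hC0, hC⟩ := exists_abs_sum_vonMangoldt_div_sub_log_le
  obtain ⟨K, hK0, hK⟩ := exists_sum_nonprime_vonMangoldt_div_le
  refine ⟨C + K, by positivity, fun x hx => ?_⟩
  have h1 : ∑ m ∈ Ioc 0 ⌊x⌋₊, Λ m / m =
      primeLogSum x + ∑ m ∈ Ioc 0 ⌊x⌋₊, (if m.Prime then 0 else Λ m) / m := by
    rw [primeLogSum, ← Finset.sum_add_distrib]
    refine Finset.sum_congr rfl fun m _ => ?_
    split_ifs with hp
    · simp [vonMangoldt_apply_prime hp]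
    · rw [zero_add]
  have h2 : 0 ≤ ∑ m ∈ Ioc 0 ⌊x⌋₊, (if m.Prime then 0 else Λ m) / (m : ℝ) := by
    refine Finset.sum_nonneg fun m _ => ?_
    split_ifs
    · simp
    · exact div_nonneg vonMangoldt_nonneg (Nat.cast_nonneg _)
  have h3 := hC x hx
  have h4 := hK ⌊x⌋₊
  rw [h1] at h3
  rw [abs_le] at *
  constructor <;> linarith

/-- Selberg's symmetry formula in short intervals. -/
theorem exists_abs_selberg_sub_le :
    ∃ C : ℝ, 0 ≤ C ∧ ∀ ε x : ℝ, 0 < ε → ε ≤ 1 → 1 ≤ x →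
      |(ψ ((1 + ε) * x) - ψ x) * log x +
        ∑ a ∈ Ioc 0 ⌊(1 + ε) * x⌋₊, Λ a * (ψ ((1 + ε) * x / a) - ψ (x / a)) -
          2 * ε * x * log x| ≤ C * x := by
  obtain ⟨C, hC0, hC⟩ := exists_abs_selberg_le
  refine ⟨3 * C + 2 * (log 4 + 4) + 4, by positivity, fun ε x hε hε1 hx => ?_⟩
  set y := (1 + ε) * x with hy
  have hx0 : 0 < x := by linarith
  have hxy : x ≤ y := by nlinarith
  have hy2 : y ≤ 2 * x := by nlinarith
  have hlogy : log y = log (1 + ε) + log x := log_mul (by linarith) (by linarith)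
  have hl0 : 0 ≤ log (1 + ε) := log_nonneg (by linarith)
  have hl1 : log (1 + ε) ≤ 1 := by linarith [log_le_sub_one_of_pos (show 0 < 1 + ε by linarith)]
  have hx' := hC x hx
  have hy' := hC y (hx.trans hxy)
  have hsum : ∑ a ∈ Ioc 0 ⌊x⌋₊, Λ a * ψ (x / a) = ∑ a ∈ Ioc 0 ⌊y⌋₊, Λ a * ψ (x / a) := by
    refine Finset.sum_subset (Ioc_subset_Ioc_right (Nat.floor_mono hxy)) fun a ha ha' => ?_
    simp only [mem_Ioc, not_and, not_le] at ha ha'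
    have h1 : x < a := (Nat.floor_lt hx0.le).1 (ha' ha.1)
    rw [Chebyshev.psi_eq_zero_of_lt_two, mul_zero]
    rw [div_lt_iff₀ (by linarith)]
    linarith
  simp_rw [mul_sub]
  rw [Finset.sum_sub_distrib, ← hsum]
  have hpsi := Chebyshev.psi_le_const_mul_self (hx0.le.trans hxy)
  have hψl0 : 0 ≤ ψ y * log (1 + ε) := mul_nonneg (Chebyshev.psi_nonneg y) hl0
  have hψl1 : ψ y * log (1 + ε) ≤ 2 * (log 4 + 4) * x := by
    calc ψ y * log (1 + ε) ≤ ψ y * 1 := by gcongr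
      _ ≤ (log 4 + 4) * y := by linarith
      _ ≤ (log 4 + 4) * (2 * x) := by gcongr
      _ = _ := by ring
  have hyl0 : 0 ≤ y * log (1 + ε) := mul_nonneg (by linarith) hl0
  have hyl1 : y * log (1 + ε) ≤ 2 * x := by
    calc y * log (1 + ε) ≤ (2 * x) * 1 := by gcongr
      _ = _ := by ring
  have hCy : C * y ≤ 2 * (C * x) := by nlinarith
  rw [hlogy] at hy'
  have e1 : 2 * y * (log (1 + ε) + log x) =
      2 * (y * log (1 + ε)) + 2 * x * log x + 2 * ε * x * log x := by rw [hy]; ring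
  rw [e1, mul_add] at hy'
  rw [abs_le] at *
  constructor <;> linarith

theorem exists_psi_sub_le :
    ∃ C : ℝ, 0 ≤ C ∧ ∀ ε x : ℝ, 0 < ε → ε ≤ 1 → 1 < x →
      ψ ((1 + ε) * x) - ψ x ≤ x * (2 * ε + C / log x) := by
  obtain ⟨C, hC0, hC⟩ := exists_abs_selberg_sub_le
  refine ⟨C, hC0, fun ε x hε hε1 hx => ?_⟩
  have hl := log_pos hx
  have h1 := (abs_le.1 (hC ε x hε hε1 hx.le)).2
  have h2 : 0 ≤ ∑ a ∈ Ioc 0 ⌊(1 + ε) * x⌋₊, Λ a * (ψ ((1 + ε) * x / a) - ψ (x / a)) := by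
    refine Finset.sum_nonneg fun a _ => mul_nonneg vonMangoldt_nonneg (sub_nonneg.2 ?_)
    apply Chebyshev.psi_mono
    gcongr
    nlinarith
  have h3 : (ψ ((1 + ε) * x) - ψ x) * log x ≤ (x * (2 * ε + C / log x)) * log x := by
    have : (x * (2 * ε + C / log x)) * log x = 2 * ε * x * log x + C * x := by field_simp
    rw [this]; linarith
  exact le_of_mul_le_mul_right h3 hl

/-- The sum of `log p * log q` over pairs of primes `p, q ≥ z` with `p * q ∈ (x, y]`. -/
noncomputable def primePairLogSum (x y z : ℝ) : ℝ :=
  ∑ a ∈ Ioc 0 ⌊y⌋₊, ∑ b ∈ Ioc 0 ⌊y⌋₊,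
    if a.Prime ∧ b.Prime ∧ x < (a * b : ℝ) ∧ (a * b : ℝ) ≤ y ∧ z ≤ a ∧ z ≤ b
      then log a * log b else 0

theorem sum_vonMangoldt_mul_psi_sub_le {x y : ℝ} (z : ℝ) (hx : 0 ≤ x) (hxy : x ≤ y) :
    ∑ a ∈ Ioc 0 ⌊y⌋₊, Λ a * (ψ (y / a) - ψ (x / a)) ≤ primePairLogSum x y z +
      2 * ∑ a ∈ Ioc 0 ⌊y⌋₊, (if a.Prime ∧ z ≤ a then 0 else Λ a) * (ψ (y / a) - ψ (x / a)) := by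
  simp_rw [Chebyshev.psi]
  rw [sum_mul_sum_Ioc_floor_div_sub _ _ hx hxy, sum_mul_sum_Ioc_floor_div_sub _ _ hx hxy, two_mul]
  nth_rw 3 [Finset.sum_comm]
  rw [primePairLogSum]
  simp_rw [← Finset.sum_add_distrib]
  refine Finset.sum_le_sum fun a _ => Finset.sum_le_sum fun b _ => ?_
  have ha := vonMangoldt_nonneg (n := a)
  have hb := vonMangoldt_nonneg (n := b)
  have hab := mul_nonneg ha hb
  rw [mul_comm (b : ℝ) (a : ℝ)]
  by_cases hR : x < (a * b : ℝ) ∧ (a * b : ℝ) ≤ y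
  · by_cases h1 : a.Prime ∧ z ≤ a
    · by_cases h2 : b.Prime ∧ z ≤ b
      · simp [hR, h1, h2, vonMangoldt_apply_prime h1.1, vonMangoldt_apply_prime h2.1]
      · have h3 : ¬ (a.Prime ∧ b.Prime ∧ x < (a * b : ℝ) ∧ (a * b : ℝ) ≤ y ∧ z ≤ a ∧ z ≤ b) := by
          tauto
        simp [hR, h1, h2, mul_comm]
    · have h3 : ¬ (a.Prime ∧ b.Prime ∧ x < (a * b : ℝ) ∧ (a * b : ℝ) ≤ y ∧ z ≤ a ∧ z ≤ b) := by
        tauto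
      rw [if_pos hR, if_neg h3, if_pos hR, if_neg h1, if_pos hR]
      split_ifs <;> nlinarith
  · have h3 : ¬ (a.Prime ∧ b.Prime ∧ x < (a * b : ℝ) ∧ (a * b : ℝ) ≤ y ∧ z ≤ a ∧ z ≤ b) := by
      tauto
    simp [hR, h3]

theorem exists_sum_exceptional_le :
    ∃ C : ℝ, 0 ≤ C ∧ ∀ ε x z : ℝ, 0 < ε → ε ≤ 1 → 1 < x → 1 ≤ z → z ≤ √x →
      ∑ a ∈ Ioc 0 ⌊(1 + ε) * x⌋₊, (if a.Prime ∧ z ≤ a then 0 else Λ a) *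
          (ψ ((1 + ε) * x / a) - ψ (x / a)) ≤
        C * x + x * ((log z + C) * (2 * ε + C / log x)) := by
  obtain ⟨C₁, hC₁0, hC₁⟩ := exists_psi_sub_le
  obtain ⟨C₂, hC₂0, hC₂⟩ := exists_abs_sum_vonMangoldt_div_sub_log_le
  obtain ⟨K, hK0, hK⟩ := exists_sum_nonprime_vonMangoldt_div_le
  refine ⟨2 * (log 4 + 4) * K + 2 * C₁ + C₂, by positivity, fun ε x z hε hε1 hx hz hzx => ?_⟩
  have hx0 : 0 < x := by linarith
  have hlx := log_pos hx
  set y := (1 + ε) * x with hy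
  have hxy : x ≤ y := by nlinarith
  have hy2 : y ≤ 2 * x := by nlinarith
  have hsx : √x ≤ x := by
    rw [sqrt_le_left hx0.le]; nlinarith
  have hsplit : ∀ a ∈ Ioc 0 ⌊y⌋₊,
      (if a.Prime ∧ z ≤ a then 0 else Λ a) * (ψ (y / a) - ψ (x / a)) ≤
      (log 4 + 4) * y * ((if a.Prime then 0 else Λ a) / a) +
        if (a : ℝ) ≤ z then x * (2 * ε + 2 * C₁ / log x) * (Λ a / a) else 0 := by
    intro a ha
    have ha0 : 0 < a := (mem_Ioc.1 ha).1
    have ha' : (0 : ℝ) < a := by exact_mod_cast ha0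
    have hΛ := vonMangoldt_nonneg (n := a)
    have hnp : 0 ≤ (log 4 + 4) * y * ((if a.Prime then 0 else Λ a) / a) := by
      split_ifs <;> positivity
    have hsm : 0 ≤ if (a : ℝ) ≤ z then x * (2 * ε + 2 * C₁ / log x) * (Λ a / a) else 0 := by
      split_ifs <;> positivity
    by_cases hp : a.Prime
    · by_cases hza : z ≤ a
      · rw [if_pos ⟨hp, hza⟩, zero_mul]; positivity
      · push Not at hza
        have hax : (a : ℝ) < √x := hza.trans_le hzx
        have h1 : √x < x / a := by
          rw [lt_div_iff₀ ha']
          nlinarith [mul_self_sqrt hx0.le]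
        have hs1 : 1 ≤ √x := hz.trans hzx
        have h2 := hC₁ ε (x / a) hε hε1 (by linarith)
        have h3 : log x / 2 ≤ log (x / a) := by
          rw [← log_sqrt hx0.le]
          exact log_le_log (by linarith) h1.le
        rw [if_neg (by simp [hza]), if_pos hza.le]
        have h4 : ψ (y / a) - ψ (x / a) ≤ x / a * (2 * ε + 2 * C₁ / log x) := by
          rw [hy, mul_div_assoc]
          have h5 : C₁ / log (x / a) ≤ 2 * C₁ / log x := by
            calc C₁ / log (x / a) ≤ C₁ / (log x / 2) := by gcongr
              _ = _ := by field_simp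
          exact h2.trans (mul_le_mul_of_nonneg_left (by linarith) (by positivity))
        calc Λ a * (ψ (y / a) - ψ (x / a)) ≤ Λ a * (x / a * (2 * ε + 2 * C₁ / log x)) := by gcongr
          _ = x * (2 * ε + 2 * C₁ / log x) * (Λ a / a) := by ring
          _ ≤ _ := by linarith
    · have h1 : ψ (y / a) - ψ (x / a) ≤ (log 4 + 4) * (y / a) := by
        linarith [Chebyshev.psi_le_const_mul_self (x := y / a) (by positivity),
          Chebyshev.psi_nonneg (x / a)]
      calc _ = Λ a * (ψ (y / a) - ψ (x / a)) := by simp [hp]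
        _ ≤ Λ a * ((log 4 + 4) * (y / a)) := by gcongr
        _ = (log 4 + 4) * y * ((if a.Prime then 0 else Λ a) / a) := by simp [hp]; ring
        _ ≤ _ := by linarith
  have hzsum : ∑ a ∈ Ioc 0 ⌊y⌋₊,
      (if (a : ℝ) ≤ z then x * (2 * ε + 2 * C₁ / log x) * (Λ a / a) else 0) =
      x * (2 * ε + 2 * C₁ / log x) * ∑ a ∈ Ioc 0 ⌊z⌋₊, Λ a / a := by
    have := sum_Ioc_floor_div (fun a => x * (2 * ε + 2 * C₁ / log x) * (Λ a / a))
      (zero_le_one.trans hz) (show z ≤ y by linarith) one_pos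
    simp only [Nat.cast_one, div_one, one_mul] at this
    rw [← this, Finset.mul_sum]
  have hM := (abs_le.1 (hC₂ z hz)).2
  have hlz := log_nonneg hz
  set C := 2 * (log 4 + 4) * K + 2 * C₁ + C₂
  have hl4 : (0 : ℝ) ≤ log 4 := by positivity
  have hKK : 0 ≤ 2 * (log 4 + 4) * K := by positivity
  calc _ ≤ ∑ a ∈ Ioc 0 ⌊y⌋₊, ((log 4 + 4) * y * ((if a.Prime then 0 else Λ a) / a) +
        if (a : ℝ) ≤ z then x * (2 * ε + 2 * C₁ / log x) * (Λ a / a) else 0) :=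
        Finset.sum_le_sum hsplit
    _ = (log 4 + 4) * y * ∑ a ∈ Ioc 0 ⌊y⌋₊, (if a.Prime then 0 else Λ a) / (a : ℝ) +
        x * (2 * ε + 2 * C₁ / log x) * ∑ a ∈ Ioc 0 ⌊z⌋₊, Λ a / a := by
        rw [Finset.sum_add_distrib, hzsum, ← Finset.mul_sum]
    _ ≤ (log 4 + 4) * (2 * x) * K + x * (2 * ε + C / log x) * (log z + C) := by
        gcongr
        · exact hK _
        · linarith
        · linarith
    _ = 2 * (log 4 + 4) * K * x + x * ((log z + C) * (2 * ε + C / log x)) := by ring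
    _ ≤ _ := by gcongr; linarith

/-- Every short interval contains many primes or many semiprimes with large factors. -/
theorem exists_le_theta_sub_add_primePairLogSum :
    ∃ C : ℝ, 0 ≤ C ∧ ∀ ε x z : ℝ, 0 < ε → ε ≤ 1 → 1 < x → 1 ≤ z → z ≤ √x →
      2 * ε * x * log x ≤ (θ ((1 + ε) * x) - θ x) * log x + primePairLogSum x ((1 + ε) * x) z +
        2 * x * ((log z + C) * (2 * ε + C / log x)) + C * x := by
  obtain ⟨C₁, hC₁0, hC₁⟩ := exists_abs_selberg_sub_le
  obtain ⟨C₂, hC₂0, hC₂⟩ := exists_sum_exceptional_le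
  obtain ⟨C₃, hC₃⟩ := Chebyshev.psi_sub_theta_le_mul_sqrt
  refine ⟨C₁ + 2 * C₂ + 4 * |C₃|, by positivity, fun ε x z hε hε1 hx hz hzx => ?_⟩
  have hx0 : 0 < x := by linarith
  have hlx := log_pos hx
  have hlz := log_nonneg hz
  have h1 := (abs_le.1 (hC₁ ε x hε hε1 hx.le)).1
  have h2 := hC₂ ε x z hε hε1 hx hz hzx
  have h3 := sum_vonMangoldt_mul_psi_sub_le z hx0.le (show x ≤ (1 + ε) * x by nlinarith)
  have h4 := hC₃ ((1 + ε) * x)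
  have h5 := Chebyshev.theta_le_psi x
  set y := (1 + ε) * x with hy
  have hy2 : y ≤ 4 * x := by nlinarith
  have hsy : √y ≤ 2 * √x := by
    rw [sqrt_le_left (by positivity), mul_pow, sq_sqrt hx0.le]; linarith
  have hlog : log x ≤ 2 * √x := by
    have := log_le_sub_one_of_pos (sqrt_pos.2 hx0)
    rw [log_sqrt hx0.le] at this
    linarith
  have h6 : (C₃ * √y) * log x ≤ 4 * |C₃| * x := by
    calc (C₃ * √y) * log x ≤ (|C₃| * (2 * √x)) * (2 * √x) := by
          gcongr
          exact le_abs_self _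
      _ = 4 * |C₃| * (√x * √x) := by ring
      _ = _ := by rw [mul_self_sqrt hx0.le]
  have h7 : (ψ y - ψ x) * log x ≤ (θ y - θ x) * log x + 4 * |C₃| * x := by
    calc (ψ y - ψ x) * log x ≤ (θ y - θ x + C₃ * √y) * log x := by gcongr; linarith
      _ ≤ _ := by linarith
  have h8 : x * ((log z + C₂) * (2 * ε + C₂ / log x)) ≤
      x * ((log z + (C₁ + 2 * C₂ + 4 * |C₃|)) *
        (2 * ε + (C₁ + 2 * C₂ + 4 * |C₃|) / log x)) := by
    have : C₂ ≤ C₁ + 2 * C₂ + 4 * |C₃| := by linarith [abs_nonneg C₃]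
    gcongr
  linarith

open scoped Classical in
/-- The sum of `1 / p` over primes `p` in `[(1 + ε) ^ k, (1 + ε) ^ (k + 1)]`. -/
noncomputable def primeRecipSum (ε : ℝ) (k : ℕ) : ℝ :=
  ∑ p ∈ (Finset.Icc 1 ⌊(1 + ε) ^ (k + 1)⌋₊).filter
      (fun p : ℕ => p.Prime ∧ (1 + ε) ^ k ≤ (p : ℝ) ∧ (p : ℝ) ≤ (1 + ε) ^ (k + 1)),
    (1 / (p : ℝ))

open scoped Classical in
/-- The sum of `1 / (p * q)` over pairs of primes `p, q ≥ exp (ε ^ 3 * k')` with product in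
`[(1 + ε) ^ k', (1 + ε) ^ (k' + 1)]`. -/
noncomputable def semiprimeRecipSum (ε : ℝ) (k' : ℕ) : ℝ :=
  ∑ q ∈ (Finset.Icc 1 ⌊(1 + ε) ^ (k' + 1)⌋₊ ×ˢ
      Finset.Icc 1 ⌊(1 + ε) ^ (k' + 1)⌋₊).filter
      (fun q => q.1.Prime ∧ q.2.Prime ∧
        (1 + ε) ^ k' ≤ ((q.1 * q.2 : ℕ) : ℝ) ∧
        ((q.1 * q.2 : ℕ) : ℝ) ≤ (1 + ε) ^ (k' + 1) ∧
        Real.exp (ε ^ 3 * k') ≤ (q.1 : ℝ) ∧ Real.exp (ε ^ 3 * k') ≤ (q.2 : ℝ)),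
    (1 / ((q.1 : ℝ) * (q.2 : ℝ)))

theorem primeRecipSum_nonneg (ε : ℝ) (k : ℕ) : 0 ≤ primeRecipSum ε k :=
  Finset.sum_nonneg fun _ _ => by positivity

theorem semiprimeRecipSum_nonneg (ε : ℝ) (k : ℕ) : 0 ≤ semiprimeRecipSum ε k :=
  Finset.sum_nonneg fun _ _ => by positivity

theorem sum_le_mul_primeRecipSum {ε W : ℝ} {j : ℕ} (f : ℕ → ℝ) (hW : 0 ≤ W)
    (hf : ∀ p : ℕ, p.Prime → (p : ℝ) ≤ (1 + ε) ^ (j + 1) → f p ≤ W * (1 / p)) :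
    ∑ b ∈ Ioc 0 ⌊(1 + ε) ^ (j + 1)⌋₊,
      (if (1 + ε) ^ j < (b : ℝ) ∧ (b : ℝ) ≤ (1 + ε) ^ (j + 1) then
        (if b.Prime then f b else 0) else 0) ≤ W * primeRecipSum ε j := by
  rw [primeRecipSum, Finset.sum_filter, Finset.mul_sum, ← Finset.Icc_add_one_left_eq_Ioc, zero_add]
  refine Finset.sum_le_sum fun b _ => ?_
  by_cases h1 : (1 + ε) ^ j < (b : ℝ) ∧ (b : ℝ) ≤ (1 + ε) ^ (j + 1)
  · by_cases h2 : b.Prime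
    · rw [if_pos h1, if_pos h2, if_pos ⟨h2, h1.1.le, h1.2⟩]
      exact hf b h2 h1.2
    · simp [h2]
  · rw [if_neg h1]
    split_ifs <;> positivity

theorem sum_le_mul_semiprimeRecipSum {ε W : ℝ} {j : ℕ} (F : ℕ → ℕ → ℝ) (hW : 0 ≤ W)
    (hF : ∀ a b : ℕ, F a b ≤ 0 ∨ (a.Prime ∧ b.Prime ∧ (1 + ε) ^ j ≤ (a * b : ℝ) ∧
      (a * b : ℝ) ≤ (1 + ε) ^ (j + 1) ∧ exp (ε ^ 3 * j) ≤ a ∧ exp (ε ^ 3 * j) ≤ b ∧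
        F a b ≤ W * (1 / (a * b)))) :
    ∑ a ∈ Ioc 0 ⌊(1 + ε) ^ (j + 1)⌋₊, ∑ b ∈ Ioc 0 ⌊(1 + ε) ^ (j + 1)⌋₊, F a b ≤
      W * semiprimeRecipSum ε j := by
  rw [semiprimeRecipSum, Finset.sum_filter, Finset.sum_product, Finset.mul_sum,
    ← Finset.Icc_add_one_left_eq_Ioc, zero_add]
  refine Finset.sum_le_sum fun a _ => ?_
  rw [Finset.mul_sum]
  refine Finset.sum_le_sum fun b _ => ?_
  rcases hF a b with h | ⟨h1, h2, h3, h4, h5, h6, h7⟩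
  · refine h.trans ?_
    split_ifs <;> positivity
  · rw [if_pos ⟨h1, h2, by exact_mod_cast h3, by exact_mod_cast h4, h5, h6⟩]
    exact h7

theorem half_le_log_one_add {ε : ℝ} (hε : 0 < ε) (hε1 : ε ≤ 1) : ε / 2 ≤ log (1 + ε) := by
  refine le_trans ?_ (le_log_one_add_of_nonneg hε.le)
  rw [le_div_iff₀ (by linarith)]
  nlinarith

theorem log_one_add_le {ε : ℝ} (hε : 0 < ε) : log (1 + ε) ≤ ε := by
  linarith [log_le_sub_one_of_pos (show 0 < 1 + ε by linarith)]

theorem log_mul_log_le_sq {a b y : ℝ} (ha : 1 ≤ a) (hb : 1 ≤ b) (hab : a * b ≤ y) :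
    log a * log b ≤ log y ^ 2 := by
  have hla : log a ≤ log y :=
    log_le_log (by linarith) ((le_mul_of_one_le_right (by linarith) hb).trans hab)
  have hlb : log b ≤ log y :=
    log_le_log (by linarith) ((le_mul_of_one_le_left (by linarith) ha).trans hab)
  rw [sq]
  exact mul_le_mul hla hlb (log_nonneg hb) ((log_nonneg ha).trans hla)

theorem theta_sub_le_mul_primeRecipSum {ε : ℝ} (hε : 0 < ε) (j : ℕ) :
    θ ((1 + ε) ^ (j + 1)) - θ ((1 + ε) ^ j) ≤
      (1 + ε) ^ (j + 1) * log ((1 + ε) ^ (j + 1)) * primeRecipSum ε j := by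
  have h1 : (1 : ℝ) ≤ (1 + ε) ^ (j + 1) := one_le_pow₀ (by linarith)
  simp_rw [Chebyshev.theta, Finset.sum_filter]
  rw [sum_Ioc_floor_sub _ (by positivity) (pow_le_pow_right₀ (by linarith) (Nat.le_succ j))]
  refine sum_le_mul_primeRecipSum (fun b => log b) (mul_nonneg (by linarith) (log_nonneg h1)) ?_
  intro p hp hpy
  have hp0 : (0 : ℝ) < p := by exact_mod_cast hp.pos
  have hlog : log p ≤ log ((1 + ε) ^ (j + 1)) := log_le_log hp0 hpy
  rw [mul_one_div, le_div_iff₀ hp0, mul_comm]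
  exact mul_le_mul hpy hlog (log_natCast_nonneg p) (by linarith)

theorem primeLogSum_sub_le_mul_primeRecipSum {ε : ℝ} (hε : 0 < ε) (j : ℕ) :
    primeLogSum ((1 + ε) ^ (j + 1)) - primeLogSum ((1 + ε) ^ j) ≤
      log ((1 + ε) ^ (j + 1)) * primeRecipSum ε j := by
  have h1 : (1 : ℝ) ≤ (1 + ε) ^ (j + 1) := one_le_pow₀ (by linarith)
  simp_rw [primeLogSum]
  rw [sum_Ioc_floor_sub _ (by positivity) (pow_le_pow_right₀ (by linarith) (Nat.le_succ j))]
  refine sum_le_mul_primeRecipSum (fun b => log b / b) (log_nonneg h1) ?_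
  intro p hp hpy
  have hp0 : (0 : ℝ) < p := by exact_mod_cast hp.pos
  rw [mul_one_div]
  gcongr

theorem primePairLogSum_le_mul_semiprimeRecipSum {ε : ℝ} (hε : 0 < ε) (j : ℕ) :
    primePairLogSum ((1 + ε) ^ j) ((1 + ε) ^ (j + 1)) (exp (ε ^ 3 * j)) ≤
      (1 + ε) ^ (j + 1) * log ((1 + ε) ^ (j + 1)) ^ 2 * semiprimeRecipSum ε j := by
  rw [primePairLogSum]
  refine sum_le_mul_semiprimeRecipSum _ (by positivity) fun a b => ?_
  split_ifs with h
  · obtain ⟨ha, hb, h1, h2, h3, h4⟩ := h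
    refine Or.inr ⟨ha, hb, h1.le, h2, h3, h4, ?_⟩
    have ha1 : (1 : ℝ) ≤ a := by exact_mod_cast ha.one_le
    have hb1 : (1 : ℝ) ≤ b := by exact_mod_cast hb.one_le
    rw [mul_one_div, le_div_iff₀ (by positivity), mul_comm]
    exact mul_le_mul h2 (log_mul_log_le_sq ha1 hb1 h2)
      (mul_nonneg (log_nonneg ha1) (log_nonneg hb1)) (by positivity)
  · exact Or.inl le_rfl

set_option maxHeartbeats 1000000 in
theorem exists_forall_le_primeRecipSum_or_le_semiprimeRecipSum {ε : ℝ} (hε : 0 < ε)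
    (hε1 : ε < 1 / 100) :
    ∃ K : ℕ, ∀ j : ℕ, K ≤ j → ε / j ≤ primeRecipSum ε j ∨ ε / j ≤ semiprimeRecipSum ε j := by
  obtain ⟨C, hC0, hC⟩ := exists_le_theta_sub_add_primePairLogSum
  set D := 9 * C + 2 * C ^ 2 with hD
  refine ⟨⌈4 * D / ε ^ 2 + 2 / ε⌉₊ + 1, fun j hj => ?_⟩
  by_contra! hcon
  obtain ⟨hA, hB⟩ := hcon
  have hj' : 4 * D / ε ^ 2 + 2 / ε + 1 ≤ j := by
    have h1 := Nat.le_ceil (4 * D / ε ^ 2 + 2 / ε)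
    have h2 : ((⌈4 * D / ε ^ 2 + 2 / ε⌉₊ + 1 : ℕ) : ℝ) ≤ j := by exact_mod_cast hj
    push_cast at h2
    linarith
  have hD0 : 0 ≤ D := by positivity
  have hq1 : 0 ≤ 4 * D / ε ^ 2 := by positivity
  have hq2 : 0 ≤ 2 / ε := by positivity
  have hj1 : (1 : ℝ) ≤ j := by linarith
  have hlam1 := half_le_log_one_add hε (by linarith)
  have hlam2 := log_one_add_le hε
  set l := log (1 + ε) with hl
  have hxlog : log ((1 + ε) ^ j) = j * l := log_pow _ _
  have hylog : log ((1 + ε) ^ (j + 1)) = (j + 1) * l := by rw [log_pow]; push_cast; rfl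
  have hyx : (1 + ε) ^ (j + 1) = (1 + ε) * (1 + ε) ^ j := pow_succ' _ _
  have hA0 := primeRecipSum_nonneg ε j
  have hB0 := semiprimeRecipSum_nonneg ε j
  have hθ := theta_sub_le_mul_primeRecipSum hε j
  have hP := primePairLogSum_le_mul_semiprimeRecipSum hε j
  have hx1 : 1 < (1 + ε) ^ j := one_lt_pow₀ (by linarith) (by rintro rfl; simp at hj1; linarith)
  rw [hylog, hyx] at hθ hP
  set x := (1 + ε) ^ j with hx
  set L : ℝ := j * l with hL
  have hx0 : 0 < x := by linarith
  have hl0 : 0 < l := by linarith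
  have hLj : j * ε / 2 ≤ L := by rw [hL]; nlinarith
  have hLj2 : L ≤ j * ε := by rw [hL]; gcongr
  have hL1 : 1 ≤ L := by
    have : 2 / ε ≤ j := by linarith
    rw [div_le_iff₀ hε] at this
    linarith
  have hDL : D ≤ ε * L / 2 := by
    have : 4 * D / ε ^ 2 ≤ j := by linarith
    rw [div_le_iff₀ (by positivity)] at this
    nlinarith
  have hzx : exp (ε ^ 3 * j) ≤ √x := by
    rw [le_sqrt (exp_pos _).le hx0.le, ← exp_nat_mul, ← le_log_iff_exp_le hx0, hxlog]
    push_cast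
    nlinarith [mul_pos hε (mul_pos hε (by linarith : (0 : ℝ) < j)),
      mul_nonneg hε.le (by linarith : (0 : ℝ) ≤ j)]
  have hmain := hC ε x (exp (ε ^ 3 * j)) hε (by linarith) hx1 (one_le_exp (by positivity)) hzx
  rw [hxlog, log_exp] at hmain
  have hlz : ε ^ 3 * j ≤ 2 * ε ^ 2 * L := by nlinarith [mul_le_mul_of_nonneg_left hLj (sq_nonneg ε)]
  have hyl : (j + 1) * l ≤ 2 * L := by rw [hL]; nlinarith
  have hyl2 : (j + 1) * l ≤ 2 * j * ε := by linarith
  have hyl0 : 0 ≤ (j + 1) * l := by positivity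
  have hy2 : (1 + ε) * x ≤ 2 * x := by nlinarith
  have hθ' : (θ ((1 + ε) * x) - θ x) * L ≤ 4 * ε ^ 2 * x * L := by
    gcongr
    calc _ ≤ (1 + ε) * x * ((j + 1) * l) * primeRecipSum ε j := hθ
      _ ≤ 2 * x * (2 * j * ε) * (ε / j) := by gcongr
      _ = _ := by field_simp; ring
  have hP' : primePairLogSum x ((1 + ε) * x) (exp (ε ^ 3 * j)) ≤ 8 * ε ^ 2 * x * L := by
    calc _ ≤ (1 + ε) * x * ((j + 1) * l) ^ 2 * semiprimeRecipSum ε j := hP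
      _ = (1 + ε) * x * (((j + 1) * l) * ((j + 1) * l)) * semiprimeRecipSum ε j := by ring
      _ ≤ 2 * x * ((2 * L) * (2 * j * ε)) * (ε / j) := by gcongr
      _ = _ := by field_simp; ring
  have hE : 2 * x * ((ε ^ 3 * j + C) * (2 * ε + C / L)) + C * x ≤
      8 * ε ^ 3 * x * L + x * D := by
    have hCL : C / L ≤ C := div_le_self hC0 hL1
    calc _ ≤ 2 * x * ((2 * ε ^ 2 * L + C) * (2 * ε + C / L)) + C * x := by gcongr
      _ = 8 * ε ^ 3 * x * L + x * (4 * ε ^ 2 * C + 4 * ε * C + 2 * C * (C / L) + C) := by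
        field_simp; ring
      _ ≤ 8 * ε ^ 3 * x * L + x * (4 * 1 ^ 2 * C + 4 * 1 * C + 2 * C * C + C) := by
        gcongr <;> linarith
      _ = _ := by rw [hD]; ring
  have hxD : x * D ≤ x * (ε * L / 2) := by gcongr
  have hpos : 0 < ε * x * L := by positivity
  have h5 : ε ^ 2 * x * L ≤ 1 / 100 * (ε * x * L) := by nlinarith
  have h6 : ε ^ 3 * x * L ≤ 1 / 100 * (ε * x * L) := by nlinarith
  linarith

theorem exists_forall_exists_le_primeRecipSum :
    ∃ ε₁ : ℝ, 0 < ε₁ ∧ ∀ ε : ℝ, 0 < ε → ε < ε₁ → ∀ k₀ : ℕ, 1 ≤ k₀ →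
      ∃ i ≤ ⌊ε⁻¹ ^ 2⌋₊, ε / (k₀ + i : ℕ) ≤ primeRecipSum ε (k₀ + i) := by
  obtain ⟨C, hC0, hC⟩ := exists_abs_primeLogSum_sub_log_le
  refine ⟨1 / (4 * C + 8), by positivity, fun ε hε hε1 k₀ hk₀ => ?_⟩
  by_contra! hcon
  set N := ⌊ε⁻¹ ^ 2⌋₊ with hN
  rw [lt_div_iff₀ (by positivity)] at hε1
  have hεs : ε < 1 := by nlinarith
  have hlam1 := half_le_log_one_add hε hεs.le
  have hlam2 := log_one_add_le hε
  have hNl : (N : ℝ) ≤ ε⁻¹ ^ 2 := Nat.floor_le (by positivity)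
  have hNu : ε⁻¹ ^ 2 < N + 1 := Nat.lt_floor_add_one _
  have hone : ∀ j : ℕ, 1 ≤ (1 + ε) ^ j := fun j => one_le_pow₀ (by linarith)
  have hstep : ∀ i ∈ range (N + 1),
      primeLogSum ((1 + ε) ^ (k₀ + (i + 1))) - primeLogSum ((1 + ε) ^ (k₀ + i)) ≤ 2 * ε ^ 2 := by
    intro i hi
    have h1 := primeLogSum_sub_le_mul_primeRecipSum hε (k₀ + i)
    have h0 := primeRecipSum_nonneg ε (k₀ + i)
    have h2 := hcon i (by simpa [Nat.lt_succ_iff] using hi)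
    have hj : (1 : ℝ) ≤ (k₀ + i : ℕ) := by exact_mod_cast (by omega : 1 ≤ k₀ + i)
    rw [log_pow, Nat.cast_add_one] at h1
    set j : ℝ := ((k₀ + i : ℕ) : ℝ)
    calc _ ≤ (j + 1) * log (1 + ε) * primeRecipSum ε (k₀ + i) := h1
      _ ≤ (2 * j) * ε * (ε / j) := by gcongr <;> linarith
      _ = _ := by field_simp
  have hsum := Finset.sum_le_sum hstep
  rw [Finset.sum_range_sub (fun i => primeLogSum ((1 + ε) ^ (k₀ + i)))] at hsum
  simp only [sum_const, card_range, nsmul_eq_mul, add_zero] at hsum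
  have h1 := (abs_le.1 (hC _ (hone (k₀ + (N + 1))))).1
  have h2 := (abs_le.1 (hC _ (hone k₀))).2
  rw [log_pow] at h1 h2
  push_cast at h1 hsum
  have hinv : ε * ε⁻¹ = 1 := mul_inv_cancel₀ hε.ne'
  have h3 : (N + 1 : ℝ) * (2 * ε ^ 2) ≤ 4 := by
    calc (N + 1 : ℝ) * (2 * ε ^ 2) ≤ (ε⁻¹ ^ 2 + 1) * (2 * ε ^ 2) := by gcongr
      _ = 2 * (ε * ε⁻¹) ^ 2 + 2 * ε ^ 2 := by ring
      _ ≤ 4 := by rw [hinv]; nlinarith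
  have h4 : ε⁻¹ / 2 ≤ (N + 1 : ℝ) * log (1 + ε) := by
    calc ε⁻¹ / 2 = ε⁻¹ ^ 2 * (ε / 2) := by field_simp
      _ ≤ _ := by gcongr
  have h5 : 4 * C + 8 < ε⁻¹ := by rw [← one_div, lt_div_iff₀ hε]; linarith
  nlinarith

set_option maxHeartbeats 1000000 in
theorem exists_forall_exists_le_semiprimeRecipSum :
    ∃ ε₁ : ℝ, 0 < ε₁ ∧ ∀ ε : ℝ, 0 < ε → ε < ε₁ → ∃ K : ℕ, ∀ k₀ : ℕ, K ≤ k₀ →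
      ∃ i ≤ ⌊ε⁻¹ ^ 2⌋₊, ε / (k₀ + i : ℕ) ≤ semiprimeRecipSum ε (k₀ + i) := by
  obtain ⟨C, hC0, hC⟩ := exists_abs_primeLogSum_sub_log_le
  refine ⟨1 / (8 * C + 1000), by positivity, fun ε hε hε1 => ?_⟩
  set N := ⌊ε⁻¹ ^ 2⌋₊ with hN
  refine ⟨N + 1 + ⌈32 * C / ε⌉₊, fun k₀ hk₀ => ?_⟩
  by_contra! hcon
  rw [lt_div_iff₀ (by positivity)] at hε1
  have hεs : ε < 1 / 1000 := by nlinarith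
  have hlam1 := half_le_log_one_add hε (by linarith)
  have hlam2 := log_one_add_le hε
  have hNl : (N : ℝ) ≤ ε⁻¹ ^ 2 := Nat.floor_le (by positivity)
  have hNu : ε⁻¹ ^ 2 < N + 1 := Nat.lt_floor_add_one _
  have hNk : (N + 1 : ℝ) ≤ k₀ := by exact_mod_cast (by omega : N + 1 ≤ k₀)
  have hk1 : (1 : ℝ) ≤ k₀ := by linarith [(Nat.cast_nonneg N : (0 : ℝ) ≤ N)]
  have hCk : 32 * C ≤ k₀ * ε := by
    rw [← div_le_iff₀ hε]
    exact (Nat.le_ceil _).trans (by exact_mod_cast (by omega : ⌈32 * C / ε⌉₊ ≤ k₀))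
  have hone : ∀ j : ℕ, 1 ≤ (1 + ε) ^ j := fun j => one_le_pow₀ (by linarith)
  set x₀ := (1 + ε) ^ k₀ with hx₀
  have hx₀1 : 1 ≤ x₀ := hone k₀
  have hw1 : 1 ≤ √x₀ := one_le_sqrt.2 hx₀1
  have hww : √x₀ * √x₀ = x₀ := mul_self_sqrt (by linarith)
  have hlogw : log (√x₀) = k₀ * log (1 + ε) / 2 := by
    rw [log_sqrt (by linarith), hx₀, log_pow]
  set z := exp (ε ^ 3 * (2 * k₀)) with hz
  have hz1 : 1 ≤ z := one_le_exp (by positivity)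
  have hlogz : log z = ε ^ 3 * (2 * k₀) := log_exp _
  have hε3 : ε ^ 3 * (2 * k₀) ≤ k₀ * ε / 16 := by
    have : ε ^ 2 ≤ 1 / 32 := by nlinarith
    nlinarith [mul_le_mul_of_nonneg_left this (by positivity : 0 ≤ k₀ * ε * 2)]
  have hkl : k₀ * (ε / 2) ≤ k₀ * log (1 + ε) := by gcongr
  have hzw : z ≤ √x₀ := by
    rw [← log_le_log_iff (by linarith) (by linarith), hlogz, hlogw]
    nlinarith [mul_pos hε (by linarith : (0 : ℝ) < k₀)]
  set P : ℕ → ℝ := fun a => if z < (a : ℝ) ∧ (a : ℝ) ≤ √x₀ then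
    (if a.Prime then log a / a else 0) else 0 with hP
  set f : ℕ → ℝ := fun b => if b.Prime then log b / b else 0 with hf
  have hP0 : ∀ a, 0 ≤ P a := fun a => by
    simp only [hP]; split_ifs <;> first | exact le_rfl | positivity
  have hPsum : k₀ * ε / 8 ≤ ∑ a ∈ Ioc 0 ⌊√x₀⌋₊, P a := by
    have h1 := (abs_le.1 (hC _ hw1)).1
    have h2 := (abs_le.1 (hC _ hz1)).2
    have h3 := sum_Ioc_floor_sub f (zero_le_one.trans hz1) hzw
    rw [hlogw] at h1
    rw [hlogz] at h2
    simp only [primeLogSum] at h1 h2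
    simp only [hP, hf] at h3 ⊢
    rw [← h3]
    linarith
  have hstep : ∀ i ∈ range (N + 1), ∑ a ∈ Ioc 0 ⌊√x₀⌋₊, P a *
      (primeLogSum ((1 + ε) ^ (k₀ + (i + 1)) / a) - primeLogSum ((1 + ε) ^ (k₀ + i) / a)) ≤
        8 * k₀ * ε ^ 3 := by
    intro i hi
    have hiN : i ≤ N := by simpa [Nat.lt_succ_iff] using hi
    have h2 := hcon i hiN
    have h0 := semiprimeRecipSum_nonneg ε (k₀ + i)
    have hj : (1 : ℝ) ≤ (k₀ + i : ℕ) := by exact_mod_cast (by omega : 1 ≤ k₀ + i)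
    have hj2 : ((k₀ + i : ℕ) : ℝ) ≤ 2 * k₀ := by exact_mod_cast (by omega : k₀ + i ≤ 2 * k₀)
    have hx₀x : x₀ ≤ (1 + ε) ^ (k₀ + i) :=
      pow_le_pow_right₀ (by linarith) (Nat.le_add_right _ _)
    have hxy : (1 + ε) ^ (k₀ + i) ≤ (1 + ε) ^ (k₀ + i + 1) :=
      pow_le_pow_right₀ (by linarith) (Nat.le_succ _)
    have hext : ∑ a ∈ Ioc 0 ⌊√x₀⌋₊, P a * (primeLogSum ((1 + ε) ^ (k₀ + (i + 1)) / a) -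
        primeLogSum ((1 + ε) ^ (k₀ + i) / a)) =
        ∑ a ∈ Ioc 0 ⌊(1 + ε) ^ (k₀ + i + 1)⌋₊, P a *
          (∑ b ∈ Ioc 0 ⌊(1 + ε) ^ (k₀ + i + 1) / a⌋₊, f b -
            ∑ b ∈ Ioc 0 ⌊(1 + ε) ^ (k₀ + i) / a⌋₊, f b) := by
      refine Finset.sum_subset (Ioc_subset_Ioc_right (Nat.floor_mono ?_)) fun a ha ha' => ?_
      · nlinarith
      · simp only [mem_Ioc, not_and, not_le] at ha ha'
        have h1 : √x₀ < a := (Nat.floor_lt (sqrt_nonneg _)).1 (ha' ha.1)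
        have : P a = 0 := if_neg fun h => absurd h.2 (not_le.2 h1)
        rw [this, zero_mul]
    rw [hext, sum_mul_sum_Ioc_floor_div_sub _ _ (by positivity) hxy]
    have hbd := sum_le_mul_semiprimeRecipSum (ε := ε) (j := k₀ + i)
      (W := log ((1 + ε) ^ (k₀ + i + 1)) ^ 2)
      (fun a b => if (1 + ε) ^ (k₀ + i) < (a * b : ℝ) ∧ (a * b : ℝ) ≤ (1 + ε) ^ (k₀ + i + 1)
        then P a * f b else 0) (by positivity) ?_
    · refine hbd.trans ?_
      rw [log_pow, Nat.cast_add_one]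
      set j : ℝ := ((k₀ + i : ℕ) : ℝ)
      calc ((j + 1) * log (1 + ε)) ^ 2 * semiprimeRecipSum ε (k₀ + i)
          ≤ ((2 * j) * ε) ^ 2 * (ε / j) := by
            have hl0 : 0 ≤ log (1 + ε) := by linarith
            gcongr
            linarith
        _ = 4 * j * ε ^ 3 := by field_simp; ring
        _ ≤ 4 * (2 * k₀) * ε ^ 3 := by gcongr
        _ = _ := by ring
    · intro a b
      by_cases h : ((1 + ε) ^ (k₀ + i) < (a * b : ℝ) ∧ (a * b : ℝ) ≤ (1 + ε) ^ (k₀ + i + 1)) ∧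
          (z < (a : ℝ) ∧ (a : ℝ) ≤ √x₀) ∧ a.Prime ∧ b.Prime
      · obtain ⟨hab, haz, ha, hb⟩ := h
        have ha1 : (1 : ℝ) ≤ a := by exact_mod_cast ha.one_le
        have hb1 : (1 : ℝ) ≤ b := by exact_mod_cast hb.one_le
        have hzz : exp (ε ^ 3 * (k₀ + i : ℕ)) ≤ z := by
          rw [hz]; gcongr
        have hbw : √x₀ < b := by
          by_contra! hbw
          have := mul_le_mul haz.2 hbw (by linarith) (sqrt_nonneg _)
          linarith
        refine Or.inr ⟨ha, hb, hab.1.le, hab.2, by linarith, by linarith, ?_⟩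
        simp only [hP, hf, if_pos hab, if_pos haz, if_pos ha, if_pos hb]
        rw [div_mul_div_comm, mul_one_div]
        exact div_le_div_of_nonneg_right (log_mul_log_le_sq ha1 hb1 hab.2) (by positivity)
      · left
        simp only [hP, hf]
        split_ifs <;> first | simp | tauto
  have hsum := Finset.sum_le_sum hstep
  rw [Finset.sum_comm] at hsum
  simp only [sum_const, card_range, nsmul_eq_mul, ← Finset.mul_sum] at hsum
  have hinv : ε * ε⁻¹ = 1 := mul_inv_cancel₀ hε.ne'
  have hinv0 : 0 < ε⁻¹ := by positivity
  have h4 : ε⁻¹ / 2 ≤ (N + 1 : ℝ) * log (1 + ε) := by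
    calc ε⁻¹ / 2 = ε⁻¹ ^ 2 * (ε / 2) := by field_simp
      _ ≤ _ := by gcongr
  have h5 : 8 * C + 1000 < ε⁻¹ := by rw [← one_div, lt_div_iff₀ hε]; linarith
  have hlow : ∀ a ∈ Ioc 0 ⌊√x₀⌋₊, P a * (ε⁻¹ / 4) ≤ P a * ∑ i ∈ range (N + 1),
      (primeLogSum ((1 + ε) ^ (k₀ + (i + 1)) / a) - primeLogSum ((1 + ε) ^ (k₀ + i) / a)) := by
    intro a ha
    refine mul_le_mul_of_nonneg_left ?_ (hP0 a)
    rw [Finset.sum_range_sub (fun i => primeLogSum ((1 + ε) ^ (k₀ + i) / a))]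
    obtain ⟨ha0, haw⟩ := mem_Ioc.1 ha
    have ha' : (0 : ℝ) < a := by exact_mod_cast ha0
    have haw' : (a : ℝ) ≤ √x₀ := (Nat.le_floor_iff (sqrt_nonneg _)).1 haw
    have hax : (a : ℝ) ≤ x₀ := by nlinarith
    have hxx : x₀ ≤ (1 + ε) ^ (k₀ + (N + 1)) :=
      pow_le_pow_right₀ (by linarith) (Nat.le_add_right _ _)
    have h1 := (abs_le.1 (hC ((1 + ε) ^ (k₀ + (N + 1)) / a)
      ((one_le_div ha').2 (hax.trans hxx)))).1
    have h2 := (abs_le.1 (hC (x₀ / a) ((one_le_div ha').2 hax))).2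
    rw [log_div (by positivity) ha'.ne', log_pow] at h1
    rw [log_div (by positivity) ha'.ne', hx₀, log_pow] at h2
    push_cast at h1
    simp only [add_zero]
    nlinarith
  have hlow' := Finset.sum_le_sum hlow
  rw [← Finset.sum_mul] at hlow'
  push_cast at hsum
  have h6 : k₀ * ε / 8 * (ε⁻¹ / 4) ≤ (N + 1) * (8 * k₀ * ε ^ 3) := by
    refine le_trans ?_ (hlow'.trans hsum)
    gcongr
  have h7 : k₀ * ε / 8 * (ε⁻¹ / 4) = k₀ / 32 := by field_simp; norm_num
  have h8 : (N + 1 : ℝ) * (8 * k₀ * ε ^ 3) ≤ 16 * k₀ * ε := by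
    calc (N + 1 : ℝ) * (8 * k₀ * ε ^ 3) ≤ (ε⁻¹ ^ 2 + 1) * (8 * k₀ * ε ^ 3) := by gcongr
      _ = 8 * k₀ * ε * ((ε * ε⁻¹) ^ 2 + ε ^ 2) := by ring
      _ ≤ 8 * k₀ * ε * (1 + 1) := by rw [hinv, one_pow]; gcongr; nlinarith
      _ = _ := by ring
  rw [h7] at h6
  nlinarith

theorem exists_adjacent_of_cover (A B : ℕ → Prop) (N : ℕ) (hcov : ∀ i ≤ N, A i ∨ B i)
    (hA : ∃ i ≤ N, A i) (hB : ∃ i ≤ N, B i) :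
    ∃ i ≤ N, ∃ i' ≤ N, A i ∧ B i' ∧ |(i : ℤ) - i'| ≤ 1 := by
  by_contra! hcon
  have hAB : ∀ i ≤ N, A i → ¬ B i := fun i hi ha hb => by
    have := hcon i hi i hi ha hb
    simp at this
  have hstep : ∀ i, i + 1 ≤ N → (A i ↔ A (i + 1)) := by
    intro i hi
    constructor
    · intro ha
      refine (hcov (i + 1) hi).resolve_right fun hb => ?_
      have := hcon i (by omega) (i + 1) hi ha hb
      push_cast at this
      simp at this
    · intro ha
      refine (hcov i (by omega)).resolve_right fun hb => ?_
      have := hcon (i + 1) hi i (by omega) ha hb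
      push_cast at this
      simp at this
  have hall : ∀ i, i ≤ N → (A 0 ↔ A i) := by
    intro i
    induction i with
    | zero => intro _; rfl
    | succ n ih => intro hn; exact (ih (by omega)).trans (hstep n hn)
  obtain ⟨i, hi, hAi⟩ := hA
  obtain ⟨i', hi', hBi'⟩ := hB
  exact hAB i' hi' ((hall i' hi').1 ((hall i hi).2 hAi)) hBi'

end

open scoped Classical in
/-- Adjacent scales with many primes and many semiprimes: for every sufficiently small
`ε > 0` and every sufficiently large `k₀`, there exist `k, k' ∈ [k₀, k₀ + ε⁻²]` with
`|k - k'| ≤ 1` such that, with `I_j = [(1+ε)^j, (1+ε)^{j+1}]`,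
`∑_{p ∈ I_k} 1/p ≥ ε/k` and `∑_{p₁ p₂ ∈ I_{k'}, p₁, p₂ ≥ exp(ε³ k')} 1/(p₁p₂) ≥ ε/k'`. -/
theorem adjacent_scales :
    ∃ ε₀ : ℝ, 0 < ε₀ ∧ ∀ ε : ℝ, 0 < ε → ε < ε₀ →
      ∃ K : ℕ, ∀ k₀ : ℕ, K ≤ k₀ →
        ∃ k k' : ℕ, k₀ ≤ k ∧ (k : ℝ) ≤ k₀ + ε⁻¹ ^ 2 ∧
          k₀ ≤ k' ∧ (k' : ℝ) ≤ k₀ + ε⁻¹ ^ 2 ∧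
          |(k : ℤ) - (k' : ℤ)| ≤ 1 ∧
          (ε / k ≤ ∑ p ∈ (Finset.Icc 1 ⌊(1 + ε) ^ (k + 1)⌋₊).filter
                (fun p : ℕ => p.Prime ∧ (1 + ε) ^ k ≤ (p : ℝ) ∧ (p : ℝ) ≤ (1 + ε) ^ (k + 1)),
              (1 / (p : ℝ))) ∧
          (ε / k' ≤ ∑ q ∈ (Finset.Icc 1 ⌊(1 + ε) ^ (k' + 1)⌋₊ ×ˢ
                Finset.Icc 1 ⌊(1 + ε) ^ (k' + 1)⌋₊).filter
                (fun q => q.1.Prime ∧ q.2.Prime ∧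
                  (1 + ε) ^ k' ≤ ((q.1 * q.2 : ℕ) : ℝ) ∧
                  ((q.1 * q.2 : ℕ) : ℝ) ≤ (1 + ε) ^ (k' + 1) ∧
                  Real.exp (ε ^ 3 * k') ≤ (q.1 : ℝ) ∧ Real.exp (ε ^ 3 * k') ≤ (q.2 : ℝ)),
              (1 / ((q.1 : ℝ) * (q.2 : ℝ)))) := by
  obtain ⟨ε₁, hε₁, h₁⟩ := exists_forall_exists_le_primeRecipSum
  obtain ⟨ε₂, hε₂, h₂⟩ := exists_forall_exists_le_semiprimeRecipSum
  refine ⟨min (min ε₁ ε₂) (1 / 100), by positivity, fun ε hε hlt => ?_⟩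
  rw [lt_min_iff, lt_min_iff] at hlt
  obtain ⟨⟨hlt₁, hlt₂⟩, hlt₃⟩ := hlt
  obtain ⟨K, hK⟩ := exists_forall_le_primeRecipSum_or_le_semiprimeRecipSum hε hlt₃
  obtain ⟨K', hK'⟩ := h₂ ε hε hlt₂
  refine ⟨max K K' + 1, fun k₀ hk₀ => ?_⟩
  obtain ⟨i, hi, i', hi', hA, hB, hii⟩ := exists_adjacent_of_cover
    (fun i => ε / (k₀ + i : ℕ) ≤ primeRecipSum ε (k₀ + i))
    (fun i => ε / (k₀ + i : ℕ) ≤ semiprimeRecipSum ε (k₀ + i)) ⌊ε⁻¹ ^ 2⌋₊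
    (fun i _ => hK (k₀ + i) (by omega)) (h₁ ε hε hlt₁ k₀ (by omega)) (hK' k₀ (by omega))
  have hfloor : ∀ n ≤ ⌊ε⁻¹ ^ 2⌋₊, ((k₀ + n : ℕ) : ℝ) ≤ k₀ + ε⁻¹ ^ 2 := fun n hn => by
    have hn' := (Nat.le_floor_iff (by positivity)).1 hn
    push_cast
    linarith
  refine ⟨k₀ + i, k₀ + i', Nat.le_add_right _ _, hfloor i hi, Nat.le_add_right _ _, hfloor i' hi',
    ?_, hA, hB⟩
  push_cast
  rwa [add_sub_add_left_eq_sub]
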